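/- Let A be an associative ℝ-algebra and let x, y ∈ A satisfy the Golden noncommutative plane relation y·x = φ·(x·y). Then for every natural number n, the ordered product (x + y)·(x + (−1/φ)·y)·(x + (−1/φ)²·y)⋯(x + (−1/φ)^{n−1}·y) equals ∑_{k=0}^{n} (F_n!/(F_k!·F_{n−k}!))·(−1/φ)^{k(k−1)/2} · x^{n−k}·y^k. -/

import Mathlib

noncomputable def φ : ℝ := (1 + Real.sqrt 5) / 2

/-- The Fibonacci factorial `F_n! = F_1 ⋯ F_n`. -/
noncomputable def fibFact (n : ℕ) : ℝ := ∏ i ∈ Finset.range n, (Nat.fib (i + 1) : ℝ)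

/-- The coefficients of `∏ i < n, (x + p ^ i y)` in the basis `x ^ (n - k) y ^ k` when
`y x = q x y`. -/
def pqCoeff {R : Type*} [CommRing R] (p q : R) : ℕ → ℕ → R
  | _, 0 => 1
  | 0, _ + 1 => 0
  | n + 1, k + 1 => q ^ (k + 1) * pqCoeff p q n (k + 1) + p ^ n * pqCoeff p q n k

theorem pqCoeff_zero_right {R : Type*} [CommRing R] (p q : R) (n : ℕ) :
    pqCoeff p q n 0 = 1 := by
  cases n <;> rfl

theorem pqCoeff_succ_succ {R : Type*} [CommRing R] (p q : R) (n k : ℕ) :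
    pqCoeff p q (n + 1) (k + 1) =
      q ^ (k + 1) * pqCoeff p q n (k + 1) + p ^ n * pqCoeff p q n k :=
  rfl

theorem pqCoeff_eq_zero_of_lt {R : Type*} [CommRing R] (p q : R) {n k : ℕ} (h : n < k) :
    pqCoeff p q n k = 0 := by
  induction n generalizing k with
  | zero =>
    obtain ⟨k, rfl⟩ := Nat.exists_eq_succ_of_ne_zero h.ne'
    rfl
  | succ n ih =>
    obtain ⟨k, rfl⟩ := Nat.exists_eq_succ_of_ne_zero (Nat.ne_zero_of_lt h)
    rw [Nat.succ_eq_add_one, pqCoeff_succ_succ, ih (by omega), ih (by omega)]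
    simp

theorem pow_mul_eq_smul_of_mul_eq_smul {R A : Type*} [CommRing R] [Ring A] [Algebra R A]
    {q : R} {x y : A} (hxy : y * x = q • (x * y)) (k : ℕ) :
    y ^ k * x = q ^ k • (x * y ^ k) := by
  induction k with
  | zero => simp
  | succ k ih =>
    rw [pow_succ, mul_assoc, hxy, mul_smul_comm, ← mul_assoc, ih, smul_mul_assoc, smul_smul,
      mul_assoc, ← pow_succ']

theorem prod_add_pow_smul_eq_sum {R A : Type*} [CommRing R] [Ring A] [Algebra R A]
    (p : R) {q : R} {x y : A} (hxy : y * x = q • (x * y)) (n : ℕ) :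
    ((List.range n).map (fun k => x + p ^ k • y)).prod =
      ∑ k ∈ Finset.range (n + 1), pqCoeff p q n k • (x ^ (n - k) * y ^ k) := by
  induction n with
  | zero => simp [pqCoeff_zero_right]
  | succ n ih =>
    have hx : (∑ k ∈ Finset.range (n + 1), pqCoeff p q n k • (x ^ (n - k) * y ^ k)) * x =
        ∑ k ∈ Finset.range (n + 2), (q ^ k * pqCoeff p q n k) • (x ^ (n + 1 - k) * y ^ k) := by
      rw [Finset.sum_range_succ _ (n + 1), pqCoeff_eq_zero_of_lt p q n.lt_succ_self, mul_zero,
        zero_smul, add_zero, Finset.sum_mul]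
      refine Finset.sum_congr rfl fun k hk => ?_
      rw [smul_mul_assoc, mul_assoc, pow_mul_eq_smul_of_mul_eq_smul hxy, mul_smul_comm, smul_smul,
        ← mul_assoc, ← pow_succ, mul_comm (q ^ k), Nat.sub_add_comm (Finset.mem_range_succ_iff.1 hk)]
    have hy : (∑ k ∈ Finset.range (n + 1), pqCoeff p q n k • (x ^ (n - k) * y ^ k)) * p ^ n • y =
        ∑ k ∈ Finset.range (n + 1),
          (p ^ n * pqCoeff p q n k) • (x ^ (n + 1 - (k + 1)) * y ^ (k + 1)) := by
      rw [Finset.sum_mul]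
      refine Finset.sum_congr rfl fun k _ => ?_
      rw [mul_smul_comm, smul_mul_assoc, smul_smul, mul_assoc, ← pow_succ, Nat.add_sub_add_right]
    rw [List.range_succ, List.map_append, List.prod_append, ih, List.map_singleton,
      List.prod_singleton, mul_add, hx, hy, Finset.sum_range_succ', Finset.sum_range_succ' _ (n + 1),
      add_right_comm, ← Finset.sum_add_distrib]
    simp only [pqCoeff_succ_succ, pqCoeff_zero_right, add_smul, pow_zero, one_mul]

theorem φ_eq_goldenRatio : φ = Real.goldenRatio := rfl

theorem neg_one_div_φ : -1 / φ = Real.goldenConj := by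
  rw [φ_eq_goldenRatio, neg_div, one_div, Real.inv_goldenRatio, neg_neg]

theorem fib_add_eq_goldenRatio_goldenConj (m k : ℕ) :
    (Nat.fib (m + k) : ℝ) =
      Real.goldenRatio ^ k * Nat.fib m + Real.goldenConj ^ m * Nat.fib k := by
  simp only [Real.coe_fib_eq]
  ring

theorem fibFact_zero : fibFact 0 = 1 := by simp [fibFact]

theorem fibFact_succ (n : ℕ) : fibFact (n + 1) = fibFact n * Nat.fib (n + 1) :=
  Finset.prod_range_succ _ _

theorem fibFact_ne_zero (n : ℕ) : fibFact n ≠ 0 :=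
  Finset.prod_ne_zero_iff.2 fun i _ => by exact_mod_cast (Nat.fib_pos.2 i.succ_pos).ne'

theorem pqCoeff_golden_mul_fibFact (m k : ℕ) :
    pqCoeff Real.goldenConj Real.goldenRatio (m + k) k * (fibFact k * fibFact m) =
      fibFact (m + k) * Real.goldenConj ^ k.choose 2 := by
  induction hn : m + k generalizing m k with
  | zero =>
    obtain ⟨rfl, rfl⟩ : m = 0 ∧ k = 0 := by omega
    simp [pqCoeff_zero_right, fibFact_zero]
  | succ n ih =>
    rcases k with _ | k
    · obtain rfl : m = n + 1 := hn
      simp [pqCoeff_zero_right, fibFact_zero]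
    have hchoose : (k + 1).choose 2 = k + k.choose 2 := by
      rw [Nat.choose_succ_succ' k 1, Nat.choose_one_right]
    obtain rfl : n = m + k := by omega
    have hk := ih m k rfl
    rw [pqCoeff_succ_succ, hchoose, pow_add, fibFact_succ k, fibFact_succ (m + k)]
    rcases m with _ | m
    · rw [pqCoeff_eq_zero_of_lt _ _ (by omega)]
      simp only [zero_add] at hk ⊢
      linear_combination Real.goldenConj ^ k * (Nat.fib (k + 1) : ℝ) * hk
    · have hk' := ih m (k + 1) (by omega)
      have hfib := fib_add_eq_goldenRatio_goldenConj (m + 1) (k + 1)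
      rw [hchoose, pow_add, fibFact_succ k] at hk'
      rw [fibFact_succ m] at hk ⊢
      rw [← add_assoc] at hfib
      rw [hfib]
      linear_combination Real.goldenRatio ^ (k + 1) * (Nat.fib (m + 1) : ℝ) * hk' +
        Real.goldenConj ^ (m + 1 + k) * (Nat.fib (k + 1) : ℝ) * hk

theorem noncommutative_golden_binomial
    {A : Type*} [Ring A] [Algebra ℝ A] (x y : A)
    (hxy : y * x = φ • (x * y)) (n : ℕ) :
    ((List.range n).map (fun k => x + ((-1 / φ : ℝ) ^ k) • y)).prod =
      ∑ k ∈ Finset.range (n + 1),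
        ((fibFact n / (fibFact k * fibFact (n - k))) * (-1 / φ : ℝ) ^ (k * (k - 1) / 2)) •
          (x ^ (n - k) * y ^ k) := by
  rw [prod_add_pow_smul_eq_sum _ hxy, neg_one_div_φ, φ_eq_goldenRatio]
  refine Finset.sum_congr rfl fun k hk => ?_
  have h := pqCoeff_golden_mul_fibFact (n - k) k
  rw [Nat.sub_add_cancel (Finset.mem_range_succ_iff.1 hk)] at h
  rw [← Nat.choose_two_right, div_mul_eq_mul_div, ← h,
    mul_div_cancel_right₀ _ (mul_ne_zero (fibFact_ne_zero _) (fibFact_ne_zero _))]
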